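/- Let $R_0$ be a Noetherian commutative ring and let $R=\bigoplus_{m\in\mathbb{N}}R_m$ be an $\mathbb{N}$-graded commutative ring with degree-zero piece $R_0$ which is finitely generated as an $R_0$-algebra. Then there exists a positive integer $d$ such that for every integer $m\geq 1$ the graded piece $R_{dm}$ equals the $m$-th power of the graded piece $R_d$, i.e.\ $R_{dm}=R_d^m$, where $R_d^m$ denotes the $R_0$-submodule of $R$ spanned by all products of $m$ elements of $R_d$. -/

import Mathlib

/-- If every weight `n i` divides `L > 0`, then an exponent vector of weight at least
`(k + r) * L`, with `r` the number of variables, dominates one of weight exactly `k * L`. -/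
theorem Finsupp.exists_le_weight_eq_mul {ι : Type*} [Fintype ι] (n : ι → ℕ) {L : ℕ}
    (hL : 0 < L) (hn : ∀ i, n i ∣ L) (k : ℕ) (f : ι →₀ ℕ)
    (hf : (k + Fintype.card ι) * L ≤ weight n f) :
    ∃ g ≤ f, weight n g = k * L := by
  classical
  induction k generalizing f with
  | zero => exact ⟨0, zero_le, by simp⟩
  | succ k ih =>
    obtain ⟨i, hi⟩ : ∃ i, L < f i * n i := by
      by_contra! h
      have h₁ : weight n f ≤ Fintype.card ι * L := by
        rw [weight_apply, sum_fintype _ _ (by simp)]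
        simpa using Finset.sum_le_card_nsmul Finset.univ (fun i ↦ f i * n i) L fun i _ ↦ h i
      nlinarith
    obtain ⟨e, he⟩ := hn i
    have hle : single i e ≤ f := by
      rw [single_le_iff]
      by_contra! h
      nlinarith
    have hw : weight n (single i e) = L := by
      rw [weight_single, smul_eq_mul, he, mul_comm]
    obtain ⟨f', rfl⟩ := exists_add_of_le hle
    rw [map_add, hw] at hf
    obtain ⟨g, hg, hgw⟩ := ih f' (by linarith)
    exact ⟨single i e + g, add_le_add_right hg _, by rw [map_add, hw, hgw]; ring⟩

section Graded

variable {R A ι : Type*} [CommRing R] [CommRing A] [Algebra R A]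
  (𝒜 : ℕ → Submodule R A) [GradedAlgebra 𝒜]

/-- A monomial in homogeneous elements is homogeneous of degree its weight. -/
theorem GradedAlgebra.prod_pow_mem_weight {x : ι → A} {n : ι → ℕ} (hx : ∀ i, x i ∈ 𝒜 (n i))
    (f : ι →₀ ℕ) : (f.prod fun i k ↦ x i ^ k) ∈ 𝒜 (Finsupp.weight n f) := by
  rw [Finsupp.weight_apply]
  exact SetLike.prod_mem_graded _ _ _ fun i _ ↦ SetLike.pow_mem_graded _ (hx i)

/-- If monomials in homogeneous elements span, those of weight `k` span the degree `k` piece. -/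
theorem GradedAlgebra.le_span_weight {x : ι → A} {n : ι → ℕ} (hx : ∀ i, x i ∈ 𝒜 (n i))
    (hspan : Submodule.span R (Set.range fun f : ι →₀ ℕ ↦ f.prod fun i k ↦ x i ^ k) = ⊤)
    (k : ℕ) :
    𝒜 k ≤ Submodule.span R
      ((fun f : ι →₀ ℕ ↦ f.prod fun i k ↦ x i ^ k) '' {f | Finsupp.weight n f = k}) := by
  intro a ha
  have hmap : (⊤ : Submodule R A) ≤ (Submodule.span R
      ((fun f : ι →₀ ℕ ↦ f.prod fun i k ↦ x i ^ k) '' {f | Finsupp.weight n f = k})).comap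
      (GradedAlgebra.proj 𝒜 k) := by
    rw [← hspan, Submodule.span_le]
    rintro _ ⟨f, rfl⟩
    have hf := prod_pow_mem_weight 𝒜 hx f
    simp only [Submodule.comap_coe, Set.mem_preimage, GradedAlgebra.proj_apply, SetLike.mem_coe]
    by_cases h : Finsupp.weight n f = k
    · subst h
      rw [DirectSum.decompose_of_mem_same _ hf]
      exact Submodule.subset_span ⟨f, rfl, rfl⟩
    · rw [DirectSum.decompose_of_mem_ne _ hf h]
      exact zero_mem _
  have := hmap (Submodule.mem_top (x := a))
  rwa [Submodule.mem_comap, GradedAlgebra.proj_apply, DirectSum.decompose_of_mem_same _ ha] at this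

/-- A graded algebra of finite type whose degree zero piece is the image of the base ring is
spanned by the monomials in finitely many homogeneous elements of positive degree. -/
theorem GradedAlgebra.exists_finset_span_monomials_eq_top [Algebra.FiniteType R A]
    (h0 : 𝒜 0 = (1 : Submodule R A)) :
    ∃ (s : Finset A) (n : s → ℕ), (∀ i, 0 < n i) ∧ (∀ i : s, (i : A) ∈ 𝒜 (n i)) ∧
      Submodule.span R (Set.range fun f : s →₀ ℕ ↦ f.prod fun i k ↦ (i : A) ^ k) = ⊤ := by
  have : IsScalarTower R (𝒜 0) A := ⟨fun c x y ↦ smul_mul_assoc c (x : A) y⟩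
  have : Algebra.FiniteType (𝒜 0) A := .of_restrictScalars_finiteType R (𝒜 0) A
  obtain ⟨s, hs, hdeg⟩ := exists_finset_adjoin_eq_top_and_homogeneous_ne_zero 𝒜
  choose n hn hmem using hdeg
  refine ⟨s, fun i ↦ n i i.2, fun i ↦ Nat.pos_of_ne_zero (hn _ _), fun i ↦ hmem _ _, ?_⟩
  have hadj : Algebra.adjoin R (s : Set A) = ⊤ := by
    rw [eq_top_iff]
    intro a _
    have ha : a ∈ Algebra.adjoin (𝒜 0) (s : Set A) := hs ▸ Algebra.mem_top
    induction ha using Algebra.adjoin_induction with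
    | mem x hx => exact Algebra.subset_adjoin hx
    | algebraMap r =>
      obtain ⟨r, hr⟩ := r
      obtain ⟨c, rfl⟩ := Submodule.mem_one.1 (h0 ▸ hr)
      exact Subalgebra.algebraMap_mem _ c
    | add x y _ _ hx hy => exact add_mem (hx trivial) (hy trivial)
    | mul x y _ _ hx hy => exact mul_mem (hx trivial) (hy trivial)
  rw [← Algebra.top_toSubmodule, ← hadj, Algebra.adjoin_eq_span]
  congr 1
  ext a
  rw [SetLike.mem_coe, ← Subtype.range_coe (s := (s : Set A)), Submonoid.mem_closure_range_iff]
  exact exists_congr fun f ↦ eq_comm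

end Graded


/-- **Veronese generation lemma** (Bourbaki, Ch. III, §1).
Let `R₀` be a Noetherian commutative ring and `A = ⨁_{m ∈ ℕ} 𝒜 m` an `ℕ`-graded
commutative ring whose degree-zero piece is `R₀` (i.e. `𝒜 0` is the image of `R₀`,
the submodule `1`), finitely generated as an `R₀`-algebra.  Then there is a positive
integer `d` such that `𝒜 (d * m) = (𝒜 d) ^ m` for every `m ≥ 1`, where `(𝒜 d) ^ m`
is the `R₀`-submodule spanned by products of `m` elements of `𝒜 d`. -/
theorem veronese_generation
    (R₀ A : Type*) [CommRing R₀] [IsNoetherianRing R₀] [CommRing A] [Algebra R₀ A]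
    (𝒜 : ℕ → Submodule R₀ A) [GradedAlgebra 𝒜]
    (h0 : 𝒜 0 = (1 : Submodule R₀ A))
    (hfg : Algebra.FiniteType R₀ A) :
    ∃ d : ℕ, 0 < d ∧ ∀ m : ℕ, 1 ≤ m → 𝒜 (d * m) = 𝒜 d ^ m := by
  obtain ⟨s, n, hpos, hmem, hspan⟩ := GradedAlgebra.exists_finset_span_monomials_eq_top 𝒜 h0
  set L := ∏ i, n i
  have hL : 0 < L := Finset.prod_pos fun i _ ↦ hpos i
  set d := (Fintype.card s + 1) * L
  refine ⟨d, by positivity, fun m hm ↦ le_antisymm ?_ ?_⟩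
  · induction m, hm using Nat.le_induction with
    | base => simp
    | succ m hm ih =>
      refine (GradedAlgebra.le_span_weight 𝒜 hmem hspan _).trans (Submodule.span_le.2 ?_)
      rintro _ ⟨f, hf, rfl⟩
      rw [Set.mem_ofPred_eq] at hf
      obtain ⟨g, hg, hgw⟩ := Finsupp.exists_le_weight_eq_mul n hL
        (fun i ↦ Finset.dvd_prod_of_mem n (Finset.mem_univ i)) (Fintype.card s + 1) f (by
          rw [hf]
          have : d * 1 ≤ d * m := Nat.mul_le_mul_left d hm
          have hd : d = (Fintype.card s + 1) * L := rfl
          nlinarith)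
      obtain ⟨h, rfl⟩ := exists_add_of_le hg
      have hhw : Finsupp.weight n h = d * m := by
        rw [map_add, hgw, mul_add, mul_one] at hf
        lia
      have hG := GradedAlgebra.prod_pow_mem_weight 𝒜 hmem g
      have hH := GradedAlgebra.prod_pow_mem_weight 𝒜 hmem h
      rw [hgw] at hG
      rw [hhw] at hH
      classical
      simp only [SetLike.mem_coe]
      rw [Finsupp.prod_add_index' (by simp) (by simp [pow_add]), pow_succ']
      exact Submodule.mul_mem_mul hG (ih hH)
  · rw [Submodule.pow_eq_span_pow_set, Submodule.span_le, mul_comm]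
    intro a ha
    obtain ⟨f, rfl⟩ := Set.mem_pow.1 ha
    simpa [List.prod_ofFn] using SetLike.list_prod_ofFn_mem_graded (A := 𝒜)
      (fun _ : Fin m ↦ d) (fun i ↦ (f i : A)) fun i ↦ (f i).2
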